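/- arXiv:2006.11350 — 7 statements merged into one kernel-verified Lean document; each statement's English description precedes it below -/
import Mathlib

section
/- Let (Ω, 𝓕, P) be a probability space, C : Ω → 𝒞 a protected attribute taking values in a countable set 𝒞, Y : Ω → {0,1} a binary label, and s̄ : Ω → [0,1) a randomized score. Let 0 = i₁ < i₂ < ⋯ < i_{K+1} = 1 and I_k = [i_k, i_{k+1}) for k = 1,…,K. Assume: (a) for each k there is a function F_k : I_k → [0,1] such that for all c ∈ 𝒞, y ∈ {0,1}, and t ∈ I_k with P(s̄ ∈ I_k, C = c, Y = y) > 0, P(s̄ ≤ t | s̄ ∈ I_k, C = c, Y = y) = F_k(t) (the within-interval conditional distribution of s̄ does not depend on c or y); and (b) for every k, y, and all c₁, c₂ ∈ 𝒞 with P(C = c₁, Y = y) > 0 and P(C = c₂, Y = y) > 0, P(s̄ ∈ I_k | C = c₁, Y = y) = P(s̄ ∈ I_k | C = c₂, Y = y). Then s̄ satisfies equalized odds in the ranking sense: for all t ∈ [0,1), y ∈ {0,1}, and c₁, c₂ as above, P(s̄ ≤ t | C = c₁, Y = y) = P(s̄ ≤ t | C = c₂, Y = y). -/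
open MeasureTheory ProbabilityTheory

/-- Two measures that agree on the part of `s` in each cell `[i k, i (k + 1))` of a monotone
subdivision agree on the part of `s` in the whole range of the subdivision. -/
theorem measure_inter_Ico_eq_of_forall_cell {α : Type*} [MeasurableSpace α] {μ ν : Measure α}
    {f : α → ℝ} (hf : Measurable f) {s : Set α} {K : ℕ} {i : Fin (K + 1) → ℝ} (hi : Monotone i)
    (h : ∀ k : Fin K, μ (s ∩ f ⁻¹' Set.Ico (i k.castSucc) (i k.succ))
      = ν (s ∩ f ⁻¹' Set.Ico (i k.castSucc) (i k.succ))) (j : Fin (K + 1)) :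
    μ (s ∩ f ⁻¹' Set.Ico (i 0) (i j)) = ν (s ∩ f ⁻¹' Set.Ico (i 0) (i j)) := by
  induction j using Fin.induction with
  | zero => simp
  | succ k ih =>
    have hcell : MeasurableSet (f ⁻¹' Set.Ico (i 0) (i k.castSucc)) := hf measurableSet_Ico
    have hdiff : (f ⁻¹' Set.Ico (i 0) (i k.succ)) \ (f ⁻¹' Set.Ico (i 0) (i k.castSucc)) =
        f ⁻¹' Set.Ico (i k.castSucc) (i k.succ) := by
      have h0 : i 0 ≤ i k.castSucc := hi (Fin.zero_le _)
      ext x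
      simp only [Set.mem_sdiff, Set.mem_preimage, Set.mem_Ico]
      grind
    have hsub : f ⁻¹' Set.Ico (i 0) (i k.castSucc) ⊆ f ⁻¹' Set.Ico (i 0) (i k.succ) :=
      Set.preimage_mono (Set.Ico_subset_Ico_right (hi k.castSucc_le_succ))
    have hsplit (ρ : Measure α) : ρ (s ∩ f ⁻¹' Set.Ico (i 0) (i k.succ)) =
        ρ (s ∩ f ⁻¹' Set.Ico (i 0) (i k.castSucc)) +
          ρ (s ∩ f ⁻¹' Set.Ico (i k.castSucc) (i k.succ)) := by
      rw [← measure_inter_add_sdiff (s ∩ f ⁻¹' Set.Ico (i 0) (i k.succ)) hcell, Set.inter_assoc,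
        Set.inter_eq_self_of_subset_right hsub, Set.inter_sdiff_assoc, hdiff]
    rw [hsplit, hsplit, ih, h k]

/-- Conditionally on `A`, the joint probability of `T` and `B` is the product of the probability
of `T` given `B ∩ A` with that of `B`. -/
theorem cond_inter_eq_cond_mul {Ω : Type*} [MeasurableSpace Ω] (P : Measure Ω)
    [IsFiniteMeasure P] {A B : Set Ω} (hA : MeasurableSet A) (hB : MeasurableSet B) (T : Set Ω) :
    P[T ∩ B | A] = P[T | B ∩ A] * P[B | A] := by
  rw [Set.inter_comm T B, ← cond_mul_eq_inter hB T P[|A],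
    cond_cond_eq_cond_inter hA hB, Set.inter_comm A B]

/-- Theorem 1 of the paper: if (a) the within-interval conditional
distribution of the randomized score `s̄` is a fixed distribution `F k` per interval
(independent of the protected attribute `c` and label `y`), and (b) the conditional
interval-membership probabilities of `s̄` are equal across protected groups given each
label value, then `s̄` satisfies equalized odds in the ranking sense:
`P(s̄ ≤ t | C = c₁, Y = y) = P(s̄ ≤ t | C = c₂, Y = y)` for all thresholds `t ∈ [0,1)`,
both labels `y`, and all groups `c₁, c₂` with positive conditioning probability. -/
theorem equalized_odds_reranking
    {Ω 𝒞 : Type*} [MeasurableSpace Ω] [Countable 𝒞]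
    (P : Measure Ω) [IsProbabilityMeasure P]
    (C : Ω → 𝒞) (Y : Ω → Bool) (sbar : Ω → ℝ)
    (hC : ∀ c, MeasurableSet {ω | C ω = c}) (hY : Measurable Y)
    (hsbar : Measurable sbar)
    (hrange : ∀ ω, sbar ω ∈ Set.Ico (0 : ℝ) 1)
    (K : ℕ) (i : Fin (K + 1) → ℝ) (hi0 : i 0 = 0) (hiK : i (Fin.last K) = 1)
    (himono : StrictMono i)
    (I : Fin K → Set ℝ) (hI : ∀ k : Fin K, I k = Set.Ico (i k.castSucc) (i k.succ))
    (F : Fin K → ℝ → ℝ)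
    (hF01 : ∀ (k : Fin K), ∀ t ∈ I k, F k t ∈ Set.Icc (0 : ℝ) 1)
    (ha : ∀ (k : Fin K) (c : 𝒞) (y : Bool), ∀ t ∈ I k,
      0 < P ({ω | sbar ω ∈ I k} ∩ {ω | C ω = c} ∩ {ω | Y ω = y}) →
      (P[{ω | sbar ω ≤ t} |
          {ω | sbar ω ∈ I k} ∩ {ω | C ω = c} ∩ {ω | Y ω = y}]).toReal = F k t)
    (hb : ∀ (k : Fin K) (y : Bool) (c₁ c₂ : 𝒞),
      0 < P ({ω | C ω = c₁} ∩ {ω | Y ω = y}) →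
      0 < P ({ω | C ω = c₂} ∩ {ω | Y ω = y}) →
      P[{ω | sbar ω ∈ I k} | {ω | C ω = c₁} ∩ {ω | Y ω = y}]
        = P[{ω | sbar ω ∈ I k} | {ω | C ω = c₂} ∩ {ω | Y ω = y}]) :
    ∀ t ∈ Set.Ico (0 : ℝ) 1, ∀ (y : Bool) (c₁ c₂ : 𝒞),
      0 < P ({ω | C ω = c₁} ∩ {ω | Y ω = y}) →
      0 < P ({ω | C ω = c₂} ∩ {ω | Y ω = y}) →
      P[{ω | sbar ω ≤ t} | {ω | C ω = c₁} ∩ {ω | Y ω = y}]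
        = P[{ω | sbar ω ≤ t} | {ω | C ω = c₂} ∩ {ω | Y ω = y}] := by
  intro t ht y c₁ c₂ h₁ h₂
  have hA (c : 𝒞) : MeasurableSet ({ω | C ω = c} ∩ {ω | Y ω = y}) :=
    (hC c).inter (hY (measurableSet_singleton y))
  have hB (k : Fin K) : MeasurableSet {ω | sbar ω ∈ I k} := by
    rw [hI]
    exact hsbar measurableSet_Ico
  have hrestrict : {ω | sbar ω ≤ t} =
      {ω | sbar ω ≤ t} ∩ sbar ⁻¹' Set.Ico (i 0) (i (Fin.last K)) := by
    rw [hi0, hiK, eq_comm, Set.inter_eq_left]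
    exact fun ω _ => hrange ω
  rw [hrestrict]
  refine measure_inter_Ico_eq_of_forall_cell hsbar himono.monotone (fun k => ?_) _
  have hcell : sbar ⁻¹' Set.Ico (i k.castSucc) (i k.succ) = {ω | sbar ω ∈ I k} := by
    rw [hI]
    rfl
  rw [hcell]
  by_cases htk : t ∈ I k
  · rw [cond_inter_eq_cond_mul P (hA c₁) (hB k), cond_inter_eq_cond_mul P (hA c₂) (hB k),
      hb k y c₁ c₂ h₁ h₂]
    by_cases hzero : P[{ω | sbar ω ∈ I k} | {ω | C ω = c₂} ∩ {ω | Y ω = y}] = 0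
    · rw [hzero, mul_zero, mul_zero]
    have hpos (c : 𝒞) (h : P[{ω | sbar ω ∈ I k} | {ω | C ω = c} ∩ {ω | Y ω = y}] ≠ 0) :
        0 < P ({ω | sbar ω ∈ I k} ∩ {ω | C ω = c} ∩ {ω | Y ω = y}) := by
      rw [pos_iff_ne_zero, Set.inter_assoc, Set.inter_comm]
      intro h0
      exact h (by rw [cond_apply (hA c), h0, mul_zero])
    congr 1
    rw [← Set.inter_assoc, ← Set.inter_assoc, ← ENNReal.toReal_eq_toReal_iff'
      (measure_ne_top _ _) (measure_ne_top _ _),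
      ha k c₁ y t htk (hpos c₁ (hb k y c₁ c₂ h₁ h₂ ▸ hzero)), ha k c₂ y t htk (hpos c₂ hzero)]
  · rw [hI, Set.mem_Ico, not_and_or, not_le, not_lt] at htk
    rcases htk with htk | htk
    · have hempty : {ω | sbar ω ≤ t} ∩ {ω | sbar ω ∈ I k} = ∅ := by
        rw [hI, Set.eq_empty_iff_forall_notMem]
        rintro ω ⟨hle, hge, -⟩
        exact absurd (hge.trans hle) (not_le.mpr htk)
      rw [hempty, measure_empty, measure_empty]
    · have hfull : {ω | sbar ω ≤ t} ∩ {ω | sbar ω ∈ I k} = {ω | sbar ω ∈ I k} := by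
        rw [hI, Set.inter_eq_right]
        exact fun ω hω => hω.2.le.trans htk
      rw [hfull, hb k y c₁ c₂ h₁ h₂]
end

section
/- Let (Ω, 𝓕, P) be a probability space, C : Ω → 𝒞 a protected attribute taking values in a countable set 𝒞, Y : Ω → {1,…,M} a categorical outcome with M ≥ 2 possible values, and s̄ : Ω → [0,1) a randomized score. Let 0 = i₁ < i₂ < ⋯ < i_{K+1} = 1 and I_k = [i_k, i_{k+1}) for k = 1,…,K. Assume: (a) for each k there is a function F_k : I_k → [0,1] such that for all c ∈ 𝒞, y ∈ {1,…,M}, and t ∈ I_k with P(s̄ ∈ I_k, C = c, Y = y) > 0, P(s̄ ≤ t | s̄ ∈ I_k, C = c, Y = y) = F_k(t); and (b) for every k, every y ∈ {1,…,M}, and all c₁, c₂ ∈ 𝒞 with P(C = c₁, Y = y) > 0 and P(C = c₂, Y = y) > 0, P(s̄ ∈ I_k | C = c₁, Y = y) = P(s̄ ∈ I_k | C = c₂, Y = y). Then s̄ satisfies multi-outcome equalized odds in the ranking sense: for all t ∈ [0,1), y ∈ {1,…,M}, and c₁, c₂ as above, P(s̄ ≤ t | C = c₁, Y = y) = P(s̄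 ≤ t | C = c₂, Y = y). -/
open MeasureTheory ProbabilityTheory

theorem Fin.exists_mem_Ico_castSucc_succ {α : Type*} [LinearOrder α] {n : ℕ}
    (f : Fin (n + 1) → α) {x : α} (hx : x ∈ Set.Ico (f 0) (f (Fin.last n))) :
    ∃ k : Fin n, x ∈ Set.Ico (f k.castSucc) (f k.succ) := by
  by_contra! h
  have hle : ∀ j, f j ≤ x := fun j => by
    induction j using Fin.induction with
    | zero => exact hx.1
    | succ k ih => exact not_lt.1 fun hlt => h k ⟨ih, hlt⟩
  exact (hle _).not_gt hx.2

theorem Monotone.pairwise_disjoint_on_Ico_castSucc_succ {α : Type*} [LinearOrder α] {n : ℕ}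
    {f : Fin (n + 1) → α} (hf : Monotone f) :
    Pairwise (Function.onFun Disjoint fun k : Fin n => Set.Ico (f k.castSucc) (f k.succ)) := by
  refine (pairwise_disjoint_on _).2 fun j k hjk => Set.disjoint_left.2 fun x hj hk => ?_
  have hle : f j.succ ≤ f k.castSucc := hf (Fin.succ_le_castSucc_iff.2 hjk)
  exact (hj.2.trans_le hle).not_ge hk.1

theorem MeasureTheory.measure_eq_of_inter_partition_eq {Ω ι : Type*} [MeasurableSpace Ω]
    [Countable ι] {μ ν : Measure Ω} {S : ι → Set Ω} {B : Set Ω}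
    (hS : ∀ k, MeasurableSet (S k)) (hdisj : Pairwise (Function.onFun Disjoint S))
    (hcover : ⋃ k, S k = Set.univ) (hB : MeasurableSet B)
    (h : ∀ k, μ (S k ∩ B) = ν (S k ∩ B)) : μ B = ν B := by
  have hunion : B = ⋃ k, S k ∩ B := by rw [← Set.iUnion_inter, hcover, Set.univ_inter]
  have hd : Pairwise (Function.onFun Disjoint fun k => S k ∩ B) := fun j k hjk =>
    (hdisj hjk).mono Set.inter_subset_left Set.inter_subset_left
  rw [hunion, measure_iUnion hd fun k => (hS k).inter hB,
    measure_iUnion hd fun k => (hS k).inter hB]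
  exact tsum_congr h

/-- Two finite measures giving the same mass to `S`, whose conditional probabilities of `B`
given `S` agree when `S` is not null, give the same mass to `S ∩ B`. -/
theorem ProbabilityTheory.measure_inter_eq_of_cond_eq {Ω : Type*} [MeasurableSpace Ω]
    {μ ν : Measure Ω} [IsFiniteMeasure μ] [IsFiniteMeasure ν] {S B : Set Ω}
    (hS : MeasurableSet S) (hmass : μ S = ν S) (h : μ S ≠ 0 → μ[B | S] = ν[B | S]) :
    μ (S ∩ B) = ν (S ∩ B) := by
  by_cases h0 : μ S = 0
  · rw [measure_inter_null_of_null_left _ h0, measure_inter_null_of_null_left _ (hmass ▸ h0)]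
  · rw [← cond_mul_eq_inter hS B μ, ← cond_mul_eq_inter hS B ν, h h0, hmass]

/-- multi-outcome extension of Theorem 1 of the paper: with a
categorical outcome `Y` taking `M ≥ 2` values, if (a) the within-interval conditional
distribution of the randomized score `s̄` is a fixed distribution `F k` per interval
(independent of the protected attribute `c` and outcome `y`), and (b) the conditional
interval-membership probabilities of `s̄` are equal across protected groups given each
outcome value, then `s̄` satisfies multi-outcome equalized odds in the ranking sense:
`P(s̄ ≤ t | C = c₁, Y = y) = P(s̄ ≤ t | C = c₂, Y = y)` for all thresholds `t ∈ [0,1)`,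
every outcome `y ∈ {1,…,M}`, and all groups `c₁, c₂` with positive conditioning
probability. -/
theorem multi_outcome_equalized_odds_reranking
    {Ω 𝒞 : Type*} [MeasurableSpace Ω] [Countable 𝒞]
    (P : Measure Ω) [IsProbabilityMeasure P]
    (C : Ω → 𝒞) (M : ℕ) (hM : 2 ≤ M) (Y : Ω → Fin M) (sbar : Ω → ℝ)
    (hC : ∀ c, MeasurableSet {ω | C ω = c}) (hY : Measurable Y)
    (hsbar : Measurable sbar)
    (hrange : ∀ ω, sbar ω ∈ Set.Ico (0 : ℝ) 1)
    (K : ℕ) (i : Fin (K + 1) → ℝ) (hi0 : i 0 = 0) (hiK : i (Fin.last K) = 1)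
    (himono : StrictMono i)
    (I : Fin K → Set ℝ) (hI : ∀ k : Fin K, I k = Set.Ico (i k.castSucc) (i k.succ))
    (F : Fin K → ℝ → ℝ)
    (hF01 : ∀ (k : Fin K), ∀ t ∈ I k, F k t ∈ Set.Icc (0 : ℝ) 1)
    (ha : ∀ (k : Fin K) (c : 𝒞) (y : Fin M), ∀ t ∈ I k,
      0 < P ({ω | sbar ω ∈ I k} ∩ {ω | C ω = c} ∩ {ω | Y ω = y}) →
      (P[{ω | sbar ω ≤ t} |
          {ω | sbar ω ∈ I k} ∩ {ω | C ω = c} ∩ {ω | Y ω = y}]).toReal = F k t)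
    (hb : ∀ (k : Fin K) (y : Fin M) (c₁ c₂ : 𝒞),
      0 < P ({ω | C ω = c₁} ∩ {ω | Y ω = y}) →
      0 < P ({ω | C ω = c₂} ∩ {ω | Y ω = y}) →
      P[{ω | sbar ω ∈ I k} | {ω | C ω = c₁} ∩ {ω | Y ω = y}]
        = P[{ω | sbar ω ∈ I k} | {ω | C ω = c₂} ∩ {ω | Y ω = y}]) :
    ∀ t ∈ Set.Ico (0 : ℝ) 1, ∀ (y : Fin M) (c₁ c₂ : 𝒞),
      0 < P ({ω | C ω = c₁} ∩ {ω | Y ω = y}) →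
      0 < P ({ω | C ω = c₂} ∩ {ω | Y ω = y}) →
      P[{ω | sbar ω ≤ t} | {ω | C ω = c₁} ∩ {ω | Y ω = y}]
        = P[{ω | sbar ω ≤ t} | {ω | C ω = c₂} ∩ {ω | Y ω = y}] := by
  intro t ht y c₁ c₂ h₁ h₂
  have hS : ∀ k, MeasurableSet {ω | sbar ω ∈ I k} := fun k => by
    rw [hI k]
    exact hsbar measurableSet_Ico
  have hA : ∀ c, MeasurableSet ({ω | C ω = c} ∩ {ω | Y ω = y}) := fun c =>
    (hC c).inter (hY (measurableSet_singleton y))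
  refine measure_eq_of_inter_partition_eq hS (fun j k hjk => ?_) ?_
    (measurableSet_le hsbar measurable_const) fun k => ?_
  · have hd := himono.monotone.pairwise_disjoint_on_Ico_castSucc_succ hjk
    simp only [Function.onFun, ← hI] at hd
    exact hd.preimage sbar
  · refine Set.eq_univ_of_forall fun ω => Set.mem_iUnion.2 ?_
    obtain ⟨k, hk⟩ := Fin.exists_mem_Ico_castSucc_succ i (x := sbar ω) (by
      rw [hi0, hiK]
      exact hrange ω)
    exact ⟨k, (hI k).symm ▸ hk⟩
  have hmass := hb k y c₁ c₂ h₁ h₂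
  rcases lt_or_ge t (i k.castSucc) with hlt | hge
  · have hempty : {ω | sbar ω ∈ I k} ∩ {ω | sbar ω ≤ t} = ∅ := by
      refine Set.eq_empty_of_forall_notMem fun ω hω => ?_
      have hmem : sbar ω ∈ I k := hω.1
      rw [hI k] at hmem
      exact (hlt.trans_le hmem.1).not_ge hω.2
    simp only [hempty, measure_empty]
  rcases lt_or_ge t (i k.succ) with hlt | hge'
  · have hcond : ∀ c, P[{ω | sbar ω ∈ I k} | {ω | C ω = c} ∩ {ω | Y ω = y}] ≠ 0 →
        (P[|{ω | C ω = c} ∩ {ω | Y ω = y}])[{ω | sbar ω ≤ t} | {ω | sbar ω ∈ I k}] =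
          ENNReal.ofReal (F k t) := fun c hne => by
      rw [cond_apply (hA c), Set.inter_comm _ {ω | sbar ω ∈ I k}, ← Set.inter_assoc] at hne
      rw [cond_cond_eq_cond_inter (hA c) (hS k), Set.inter_comm _ {ω | sbar ω ∈ I k},
        ← Set.inter_assoc,
        ← ha k c y t ((hI k).symm ▸ ⟨hge, hlt⟩) (pos_iff_ne_zero.2 (right_ne_zero_of_mul hne)),
        ENNReal.ofReal_toReal (measure_ne_top _ _)]
    exact measure_inter_eq_of_cond_eq (hS k) hmass fun hne =>
      (hcond c₁ hne).trans (hcond c₂ (hmass ▸ hne)).symm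
  · have hsub : {ω | sbar ω ∈ I k} ⊆ {ω | sbar ω ≤ t} := fun ω hω => by
      have hmem : sbar ω ∈ I k := hω
      rw [hI k] at hmem
      exact hmem.2.le.trans hge'
    rw [Set.inter_eq_left.2 hsub, hmass]
end

section
/- Let (Ω, 𝓕, P) be a probability space, C : Ω → 𝒞 a protected attribute taking values in a countable set 𝒞, Y : Ω → {0,1} a true binary label, and Ŷ : Ω → {0,1} a binary classifier. For each y ∈ {0,1} and c ∈ 𝒞, let p_{y,c} ∈ [0,1], and let Ỹ : Ω → {0,1} be a randomized classifier such that, conditionally on {Ŷ = y, C = c, Y = y'}, Ỹ equals 1 − y with probability p_{y,c} and equals y otherwise (the flip is conditionally independent of Y given (Ŷ, C)). If for all c₁, c₂ ∈ 𝒞 and all y ∈ {0,1} with P(C = c₁, Y = y) > 0 and P(C = c₂, Y = y) > 0, (1 − p_{y,c₁})·P(Ŷ = y | C = c₁, Y = y) + p_{1−y,c₁}·P(Ŷ = 1 − y | C = c₁, Y = y) = (1 − p_{y,c₂})·P(Ŷ = y | C = c₂, Y = y) + p_{1−y,c₂}·P(Ŷ = 1 − y | C = c₂, Y = y), then Ỹ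 satisfies equalized odds: P(Ỹ = 1 | C = c₁, Y = y) = P(Ỹ = 1 | C = c₂, Y = y) for all such c₁, c₂ and y ∈ {0,1}. -/
open MeasureTheory ProbabilityTheory

/-- The probability that the flipped classifier outputs `y` given `S`, when each value `b` of the
original classifier is flipped with conditional probability `r b`. -/
lemma cond_real_eq_of_flip {Ω : Type*} [MeasurableSpace Ω] (P : Measure Ω)
    [IsProbabilityMeasure P] {S : Set Ω} (hS : MeasurableSet S) {U V : Ω → Bool}
    (hU : Measurable U) (hV : Measurable V) (r : Bool → ℝ)
    (hflip : ∀ b, 0 < P ({ω | U ω = b} ∩ S) →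
      (P[{ω | V ω = !b} | {ω | U ω = b} ∩ S]).toReal = r b)
    (y : Bool) :
    (P[{ω | V ω = y} | S]).toReal
      = (1 - r y) * (P[{ω | U ω = y} | S]).toReal
        + r (!y) * (P[{ω | U ω = !y} | S]).toReal := by
  have hmU : ∀ b, MeasurableSet {ω | U ω = b} := fun b => hU (measurableSet_singleton b)
  have hmV : ∀ b, MeasurableSet {ω | V ω = b} := fun b => hV (measurableSet_singleton b)
  have flipped : ∀ b, (P[|S]).real ({ω | U ω = b} ∩ {ω | V ω = !b})
      = r b * (P[|S]).real {ω | U ω = b} := by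
    intro b
    rcases eq_or_ne (P ({ω | U ω = b} ∩ S)) 0 with h | h
    · have h0 : P[|S] {ω | U ω = b} = 0 := by
        rw [cond_apply hS, Set.inter_comm, h, mul_zero]
      rw [measureReal_def, measureReal_def, h0,
        measure_mono_null Set.inter_subset_left h0]
      simp
    · rw [← hflip b (pos_iff_ne_zero.mpr h), Set.inter_comm {ω | U ω = b} S,
        ← cond_cond_eq_cond_inter hS (hmU b), measureReal_def, measureReal_def,
        ← ENNReal.toReal_mul, cond_mul_eq_inter (hmU b)]
  have kept := measureReal_inter_add_sdiff (μ := P[|S]) (s := {ω | U ω = y}) (hmV (!y))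
  have total := measureReal_inter_add_sdiff (μ := P[|S]) (s := {ω | V ω = y}) (hmU y)
  have hkept : {ω | V ω = y} ∩ {ω | U ω = y} = {ω | U ω = y} \ {ω | V ω = !y} := by
    ext ω
    cases h : V ω <;> cases y <;> simp [h]
  have hswap : {ω | V ω = y} \ {ω | U ω = y} = {ω | U ω = !y} ∩ {ω | V ω = !(!y)} := by
    ext ω
    cases h : U ω <;> cases y <;> simp [h]
  rw [hkept, hswap, flipped] at total
  rw [flipped] at kept
  simp only [← measureReal_def]
  linarith

/-- Section 3.1 of the paper: randomly flipping the classification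
`Ŷ = y` for group `C = c` with probability `p y c` (conditionally independently of the
true label `Y` given `(Ŷ, C)`) yields a randomized classifier `Ỹ` satisfying equalized
odds, `P(Ỹ = 1 | C = c₁, Y = y) = P(Ỹ = 1 | C = c₂, Y = y)` for both label values `y`,
whenever the stated linear constraints on the flip probabilities hold. -/
theorem randomized_flip_equalized_odds
    {Ω 𝒞 : Type*} [MeasurableSpace Ω] [Countable 𝒞]
    (P : Measure Ω) [IsProbabilityMeasure P]
    (C : Ω → 𝒞) (Y Yhat Ytil : Ω → Bool)
    (hC : ∀ c, MeasurableSet {ω | C ω = c}) (hY : Measurable Y)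
    (hYhat : Measurable Yhat) (hYtil : Measurable Ytil)
    (p : Bool → 𝒞 → ℝ) (hp : ∀ y c, p y c ∈ Set.Icc (0 : ℝ) 1)
    (hflip : ∀ (y y' : Bool) (c : 𝒞),
      0 < P ({ω | Yhat ω = y} ∩ {ω | C ω = c} ∩ {ω | Y ω = y'}) →
      (P[{ω | Ytil ω = !y} |
          {ω | Yhat ω = y} ∩ {ω | C ω = c} ∩ {ω | Y ω = y'}]).toReal = p y c)
    (hconstraint : ∀ (c₁ c₂ : 𝒞) (y : Bool),
      0 < P ({ω | C ω = c₁} ∩ {ω | Y ω = y}) →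
      0 < P ({ω | C ω = c₂} ∩ {ω | Y ω = y}) →
      (1 - p y c₁) * (P[{ω | Yhat ω = y} | {ω | C ω = c₁} ∩ {ω | Y ω = y}]).toReal
          + p (!y) c₁ *
            (P[{ω | Yhat ω = !y} | {ω | C ω = c₁} ∩ {ω | Y ω = y}]).toReal
        = (1 - p y c₂) * (P[{ω | Yhat ω = y} | {ω | C ω = c₂} ∩ {ω | Y ω = y}]).toReal
          + p (!y) c₂ *
            (P[{ω | Yhat ω = !y} | {ω | C ω = c₂} ∩ {ω | Y ω = y}]).toReal) :
    ∀ (c₁ c₂ : 𝒞) (y : Bool),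
      0 < P ({ω | C ω = c₁} ∩ {ω | Y ω = y}) →
      0 < P ({ω | C ω = c₂} ∩ {ω | Y ω = y}) →
      P[{ω | Ytil ω = true} | {ω | C ω = c₁} ∩ {ω | Y ω = y}]
        = P[{ω | Ytil ω = true} | {ω | C ω = c₂} ∩ {ω | Y ω = y}] := by
  intro c₁ c₂ y h₁ h₂
  have hS : ∀ c, MeasurableSet ({ω | C ω = c} ∩ {ω | Y ω = y}) := fun c =>
    (hC c).inter (hY (measurableSet_singleton y))
  have key : ∀ c, _ := fun c => cond_real_eq_of_flip P (hS c) hYhat hYtil (fun b => p b c)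
    (fun b hb => by
      rw [← Set.inter_assoc] at hb ⊢
      exact hflip b y c hb) y
  have heq : P[{ω | Ytil ω = y} | {ω | C ω = c₁} ∩ {ω | Y ω = y}]
      = P[{ω | Ytil ω = y} | {ω | C ω = c₂} ∩ {ω | Y ω = y}] := by
    rw [← ENNReal.toReal_eq_toReal_iff' (measure_ne_top _ _) (measure_ne_top _ _), key c₁, key c₂]
    exact hconstraint c₁ c₂ y h₁ h₂
  cases y with
  | true => exact heq
  | false =>
    have := cond_isProbabilityMeasure (μ := P) h₁.ne'
    have := cond_isProbabilityMeasure (μ := P) h₂.ne'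
    have hcompl : {ω | Ytil ω = true} = {ω | Ytil ω = false}ᶜ := by
      ext ω
      simp
    have hm : MeasurableSet {ω | Ytil ω = false} := hYtil (measurableSet_singleton false)
    rw [hcompl, prob_compl_eq_one_sub hm, prob_compl_eq_one_sub hm, heq]
end

section
/- Consider the position-bias model: on a probability space (Ω, 𝓕, P), let S : Ω → ℝ be a score, C : Ω → 𝒞 a protected attribute taking values in a countable set 𝒞, γ : Ω → {1,…,K} a position, and Y₁,…,Y_K : Ω → {0,1} counterfactual labels; write w_j = P(Y_j = 1 | Y₁ = 1). Assume homogeneity: for every j, conditionally on {Y₁ = 1}, Y_j is independent of (S, γ, C) with P(Y_j = 1 | Y₁ = 1, S, γ, C) = w_j almost surely; and assume preservation of hierarchy: for every j, Y_j ≤ Y₁ almost surely. Then for every position j, threshold t ∈ ℝ, and attribute value c with P(γ = j, Y_j = 1, C = c) > 0 and P(γ = j, Y₁ = 1, C = c) > 0: P(S ≤ t | γ = j, Y_j = 1, C = c) = P(S ≤ t | γ = j, Y₁ = 1, C = c). -/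
open MeasureTheory ProbabilityTheory

/-- If the measures of `A` and `A ∩ s` are proportional to those of `D` and `D ∩ s` with the same
finite nonzero factor, then conditioning on `A` or on `D` gives `s` the same probability. -/
theorem cond_apply_eq_of_measure_eq_mul {Ω : Type*} [MeasurableSpace Ω] (μ : Measure Ω)
    {A D s : Set Ω} (hA : MeasurableSet A) (hD : MeasurableSet D) {a : ENNReal}
    (ha : a ≠ 0) (ha' : a ≠ ⊤) (h : μ A = a * μ D) (hs : μ (A ∩ s) = a * μ (D ∩ s)) :
    μ[s | A] = μ[s | D] := by
  rw [cond_apply hA, cond_apply hD, h, hs, ENNReal.mul_inv (Or.inl ha) (Or.inl ha'),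
    mul_mul_mul_comm, ENNReal.inv_mul_cancel ha ha', one_mul]

/-- Claim 1 in the proof of Theorem 2 of the paper: in the
position-bias model with homogeneity (conditionally on `Y₁ = 1`, the counterfactual
label `Y j` is independent of `(S, γ, C)` with conditional probability `w j`) and
preservation of hierarchy (`Y j ≤ Y₁` a.s.), conditioning the score on the observed
positive response at position `j` is the same as conditioning on the counterfactual
positive response at position 1:
`P(S ≤ t | γ = j, Y_j = 1, C = c) = P(S ≤ t | γ = j, Y₁ = 1, C = c)`.
Positions are indexed by `Fin (K + 1)`, with `0` denoting position 1 (the top). -/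
theorem position_bias_claim_one
    {Ω 𝒞 : Type*} [MeasurableSpace Ω] [Countable 𝒞]
    (P : Measure Ω) [IsProbabilityMeasure P]
    (K : ℕ) (S : Ω → ℝ) (C : Ω → 𝒞) (γ : Ω → Fin (K + 1))
    (Y : Fin (K + 1) → Ω → Bool)
    (hS : Measurable S) (hC : ∀ c, MeasurableSet {ω | C ω = c})
    (hγ : Measurable γ) (hYm : ∀ j, Measurable (Y j))
    (w : Fin (K + 1) → ℝ)
    (hw : ∀ j, w j = (P[{ω | Y j ω = true} | {ω | Y 0 ω = true}]).toReal)
    (hHom : ∀ (j j' : Fin (K + 1)) (c : 𝒞) (B : Set ℝ), MeasurableSet B →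
      (P ({ω | Y j ω = true} ∩
          ({ω | S ω ∈ B} ∩ {ω | γ ω = j'} ∩ {ω | C ω = c} ∩
            {ω | Y 0 ω = true}))).toReal
        = w j * (P ({ω | S ω ∈ B} ∩ {ω | γ ω = j'} ∩ {ω | C ω = c} ∩
            {ω | Y 0 ω = true})).toReal)
    (hHier : ∀ j, ∀ᵐ ω ∂P, Y j ω = true → Y 0 ω = true) :
    ∀ (j : Fin (K + 1)) (t : ℝ) (c : 𝒞),
      0 < P ({ω | γ ω = j} ∩ {ω | Y j ω = true} ∩ {ω | C ω = c}) →
      0 < P ({ω | γ ω = j} ∩ {ω | Y 0 ω = true} ∩ {ω | C ω = c}) →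
      P[{ω | S ω ≤ t} | {ω | γ ω = j} ∩ {ω | Y j ω = true} ∩ {ω | C ω = c}]
        = P[{ω | S ω ≤ t} | {ω | γ ω = j} ∩ {ω | Y 0 ω = true} ∩ {ω | C ω = c}] := by
  intro j t c hpos _
  have w_nonneg : 0 ≤ w j := by
    rw [hw]
    exact ENNReal.toReal_nonneg
  have measure_inter (B : Set ℝ) (hB : MeasurableSet B) :
      P ({ω | γ ω = j} ∩ {ω | Y j ω = true} ∩ {ω | C ω = c} ∩ {ω | S ω ∈ B})
        = ENNReal.ofReal (w j) *
          P ({ω | γ ω = j} ∩ {ω | Y 0 ω = true} ∩ {ω | C ω = c} ∩ {ω | S ω ∈ B}) := by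
    have hj : P ({ω | γ ω = j} ∩ {ω | Y j ω = true} ∩ {ω | C ω = c} ∩ {ω | S ω ∈ B})
        = P ({ω | Y j ω = true} ∩ ({ω | S ω ∈ B} ∩ {ω | γ ω = j} ∩ {ω | C ω = c} ∩
            {ω | Y 0 ω = true})) := by
      apply measure_congr
      filter_upwards [hHier j] with ω hω
      apply propext
      change (((γ ω = j ∧ Y j ω = true) ∧ C ω = c) ∧ S ω ∈ B) ↔
        (Y j ω = true ∧ (((S ω ∈ B ∧ γ ω = j) ∧ C ω = c) ∧ Y 0 ω = true))
      tauto
    have h0 : {ω | γ ω = j} ∩ {ω | Y 0 ω = true} ∩ {ω | C ω = c} ∩ {ω | S ω ∈ B}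
        = {ω | S ω ∈ B} ∩ {ω | γ ω = j} ∩ {ω | C ω = c} ∩ {ω | Y 0 ω = true} := by
      ext ω
      simp only [Set.mem_inter_iff, Set.mem_ofPred_eq]
      tauto
    rw [hj, h0, ← ENNReal.ofReal_toReal (measure_ne_top P ({ω | Y j ω = true} ∩ _)),
      hHom j j c B hB, ENNReal.ofReal_mul w_nonneg, ENNReal.ofReal_toReal (measure_ne_top P _)]
  have h_univ := measure_inter Set.univ MeasurableSet.univ
  simp only [Set.mem_univ, Set.ofPred_true, Set.inter_univ] at h_univ
  have measurableSet_event (i : Fin (K + 1)) :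
      MeasurableSet ({ω | γ ω = j} ∩ {ω | Y i ω = true} ∩ {ω | C ω = c}) :=
    ((hγ (measurableSet_singleton j)).inter (hYm i (measurableSet_singleton true))).inter (hC c)
  have w_ne_zero : ENNReal.ofReal (w j) ≠ 0 := by
    intro h
    rw [h_univ, h, zero_mul] at hpos
    exact hpos.false
  exact cond_apply_eq_of_measure_eq_mul P (measurableSet_event j) (measurableSet_event 0)
    w_ne_zero ENNReal.ofReal_ne_top h_univ (measure_inter (Set.Iic t) measurableSet_Iic)
end

section
/- Consider the position-bias model: on a probability space (Ω, 𝓕, P), let S : Ω → ℝ be a score, C : Ω → 𝒞 a protected attribute taking values in a countable set 𝒞, γ : Ω → {1,…,K} a position, and Y₁,…,Y_K : Ω → {0,1} counterfactual labels; write Y_γ(ω) = Y_{γ(ω)}(ω) for the observed label and w_j = P(Y_j = 1 | Y₁ = 1). Assume homogeneity: for every j, conditionally on {Y₁ = 1}, Y_j is independent of (S, γ, C) with P(Y_j = 1 | Y₁ = 1, S, γ, C) = w_j almost surely; assume preservation of hierarchy: Y_j ≤ Y₁ almost surely for every j; and assume w_j > 0 for all j and P(Y_γ = 1, C = c) > 0.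 Then for every position j and attribute value c: P(γ = j | Y_γ = 1, C = c) = w_j · P(γ = j | Y₁ = 1, C = c) / Σ_{r=1}^{K} w_r · P(γ = r | Y₁ = 1, C = c). -/
open MeasureTheory ProbabilityTheory

/-- The mass of a set is the sum of its masses over the fibres of a finitely valued map. -/
lemma sum_measureReal_inter_fiber {Ω ι : Type*} [MeasurableSpace Ω] [Fintype ι]
    [MeasurableSpace ι] [MeasurableSingletonClass ι] (μ : Measure Ω) [IsFiniteMeasure μ]
    {f : Ω → ι} (hf : Measurable f) (s : Set Ω) :
    ∑ i, μ.real (s ∩ {ω | f ω = i}) = μ.real s := by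
  have hfib (i : ι) : MeasurableSet (f ⁻¹' {i}) := hf (measurableSet_singleton i)
  have h := sum_measureReal_preimage_singleton (μ := μ.restrict s) Finset.univ
    (f := f) fun i _ => hfib i
  simp only [Finset.coe_univ, Set.preimage_univ, measureReal_restrict_apply_univ] at h
  rw [← h]
  refine Finset.sum_congr rfl fun i _ => ?_
  rw [measureReal_restrict_apply (hfib i), Set.inter_comm]
  rfl

/-- Claim 2 in the proof of Theorem 2 of the paper: in the
position-bias model with homogeneity and preservation of hierarchy, and positive
position biases `w j`, the position distribution conditional on the observed positive
response satisfies the Bayes-rule identity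
`P(γ = j | Y_γ = 1, C = c)
  = w j · P(γ = j | Y₁ = 1, C = c) / ∑ r, w r · P(γ = r | Y₁ = 1, C = c)`.
Positions are indexed by `Fin (K + 1)`, with `0` denoting position 1 (the top). -/
theorem position_bias_claim_two
    {Ω 𝒞 : Type*} [MeasurableSpace Ω] [Countable 𝒞]
    (P : Measure Ω) [IsProbabilityMeasure P]
    (K : ℕ) (S : Ω → ℝ) (C : Ω → 𝒞) (γ : Ω → Fin (K + 1))
    (Y : Fin (K + 1) → Ω → Bool) (Yobs : Ω → Bool)
    (hYobs : ∀ ω, Yobs ω = Y (γ ω) ω)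
    (hS : Measurable S) (hC : ∀ c, MeasurableSet {ω | C ω = c})
    (hγ : Measurable γ) (hYm : ∀ j, Measurable (Y j))
    (w : Fin (K + 1) → ℝ)
    (hw : ∀ j, w j = (P[{ω | Y j ω = true} | {ω | Y 0 ω = true}]).toReal)
    (hwpos : ∀ j, 0 < w j)
    (hHom : ∀ (j j' : Fin (K + 1)) (c : 𝒞) (B : Set ℝ), MeasurableSet B →
      (P ({ω | Y j ω = true} ∩
          ({ω | S ω ∈ B} ∩ {ω | γ ω = j'} ∩ {ω | C ω = c} ∩
            {ω | Y 0 ω = true}))).toReal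
        = w j * (P ({ω | S ω ∈ B} ∩ {ω | γ ω = j'} ∩ {ω | C ω = c} ∩
            {ω | Y 0 ω = true})).toReal)
    (hHier : ∀ j, ∀ᵐ ω ∂P, Y j ω = true → Y 0 ω = true) :
    ∀ (j : Fin (K + 1)) (c : 𝒞),
      0 < P ({ω | Yobs ω = true} ∩ {ω | C ω = c}) →
      (P[{ω | γ ω = j} | {ω | Yobs ω = true} ∩ {ω | C ω = c}]).toReal
        = w j * (P[{ω | γ ω = j} | {ω | Y 0 ω = true} ∩ {ω | C ω = c}]).toReal /
            ∑ r, w r * (P[{ω | γ ω = r} | {ω | Y 0 ω = true} ∩ {ω | C ω = c}]).toReal := by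
  intro j c hpos
  have hE (r : Fin (K + 1)) : MeasurableSet {ω | Y r ω = true} :=
    hYm r (measurableSet_singleton true)
  have hobs : MeasurableSet {ω | Yobs ω = true} := by
    have : {ω | Yobs ω = true} = ⋃ r, {ω | γ ω = r} ∩ {ω | Y r ω = true} := by
      ext ω
      simp [hYobs]
    rw [this]
    exact .iUnion fun r => (hγ (measurableSet_singleton r)).inter (hE r)
  set A : Set Ω := {ω | Yobs ω = true} ∩ {ω | C ω = c}
  set B : Set Ω := {ω | Y 0 ω = true} ∩ {ω | C ω = c}
  have hA : MeasurableSet A := hobs.inter (hC c)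
  have hB : MeasurableSet B := (hE 0).inter (hC c)
  have key (r : Fin (K + 1)) :
      P.real (A ∩ {ω | γ ω = r}) = w r * P.real (B ∩ {ω | γ ω = r}) := by
    have h := hHom r r c Set.univ MeasurableSet.univ
    have hBset : {ω | S ω ∈ Set.univ} ∩ {ω | γ ω = r} ∩ {ω | C ω = c} ∩ {ω | Y 0 ω = true}
        = B ∩ {ω | γ ω = r} := by
      ext ω
      simp only [B, Set.mem_inter_iff, Set.mem_ofPred_eq, Set.mem_univ]
      tauto
    rw [hBset] at h
    rw [measureReal_def, measureReal_def, ← h]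
    congr 1
    refine measure_congr ?_
    filter_upwards [hHier r] with ω hω
    refine propext ?_
    change (Yobs ω = true ∧ C ω = c) ∧ γ ω = r ↔
      Y r ω = true ∧ (Y 0 ω = true ∧ C ω = c) ∧ γ ω = r
    rw [hYobs]
    constructor
    · rintro ⟨⟨hy, hc⟩, rfl⟩
      exact ⟨hy, ⟨hω hy, hc⟩, rfl⟩
    · rintro ⟨hy, ⟨-, hc⟩, rfl⟩
      exact ⟨⟨hy, hc⟩, rfl⟩
  have hAsum : ∑ r, w r * P.real (B ∩ {ω | γ ω = r}) = P.real A := by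
    rw [← sum_measureReal_inter_fiber P hγ A]
    exact Finset.sum_congr rfl fun r _ => (key r).symm
  have hApos : 0 < P.real A := ENNReal.toReal_pos hpos.ne' (measure_ne_top P A)
  have hBne : P.real B ≠ 0 := by
    intro h0
    refine hApos.ne' (hAsum ▸ Finset.sum_eq_zero fun r _ => ?_)
    rw [measureReal_mono_null Set.inter_subset_left h0, mul_zero]
  have hcond {s : Set Ω} (hs : MeasurableSet s) (r : Fin (K + 1)) :
      (P[{ω | γ ω = r} | s]).toReal = (P.real s)⁻¹ * P.real (s ∩ {ω | γ ω = r}) := by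
    rw [cond_apply hs, ENNReal.toReal_mul, ENNReal.toReal_inv]
    rfl
  simp only [hcond hA, hcond hB, key, mul_left_comm (w _), ← Finset.mul_sum, hAsum]
  field_simp
end

section
/- Consider the position-bias model: on a probability space (Ω, 𝓕, P), let S : Ω → ℝ be a score, C : Ω → 𝒞 a protected attribute taking values in a countable set 𝒞, γ : Ω → {1,…,K} a position, and Y₁,…,Y_K : Ω → {0,1} counterfactual labels with w_j = P(Y_j = 1 | Y₁ = 1) > 0 for all j. Assume homogeneity: for every j, conditionally on {Y₁ = 1}, Y_j is independent of (S, γ, C) with P(Y_j = 1 | Y₁ = 1, S, γ, C) = w_j almost surely; and preservation of hierarchy: Y_j ≤ Y₁ almost surely for every j. Then for every Borel set I ⊆ ℝ and every c ∈ 𝒞 with P(C = c) > 0: P(Y₁ = 1, S ∈ I | C = c) = Σ_{j=1}^{K} P(S ∈ I, Y_j = 1, γ = j | C = c) / w_j. -/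
open MeasureTheory ProbabilityTheory

/-- key identity in the proof of Theorem 4 of the paper: in the
position-bias model with homogeneity, preservation of hierarchy and positive position
biases `w j`, the joint probability of the counterfactual positive label and the score
falling in a Borel set is recovered from observed quantities by inverse-propensity
weighting: `P(Y₁ = 1, S ∈ I | C = c) = ∑ j P(S ∈ I, Y_j = 1, γ = j | C = c) / w_j`.
Positions are indexed by `Fin (K + 1)`, with `0` denoting position 1 (the top). -/
theorem inverse_propensity_identity_positive
    {Ω 𝒞 : Type*} [MeasurableSpace Ω] [Countable 𝒞]
    (P : Measure Ω) [IsProbabilityMeasure P]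
    (K : ℕ) (S : Ω → ℝ) (C : Ω → 𝒞) (γ : Ω → Fin (K + 1))
    (Y : Fin (K + 1) → Ω → Bool)
    (hS : Measurable S) (hC : ∀ c, MeasurableSet {ω | C ω = c})
    (hγ : Measurable γ) (hYm : ∀ j, Measurable (Y j))
    (w : Fin (K + 1) → ℝ)
    (hw : ∀ j, w j = (P[{ω | Y j ω = true} | {ω | Y 0 ω = true}]).toReal)
    (hwpos : ∀ j, 0 < w j)
    (hHom : ∀ (j j' : Fin (K + 1)) (c : 𝒞) (B : Set ℝ), MeasurableSet B →
      (P ({ω | Y j ω = true} ∩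
          ({ω | S ω ∈ B} ∩ {ω | γ ω = j'} ∩ {ω | C ω = c} ∩
            {ω | Y 0 ω = true}))).toReal
        = w j * (P ({ω | S ω ∈ B} ∩ {ω | γ ω = j'} ∩ {ω | C ω = c} ∩
            {ω | Y 0 ω = true})).toReal)
    (hHier : ∀ j, ∀ᵐ ω ∂P, Y j ω = true → Y 0 ω = true) :
    ∀ (I : Set ℝ), MeasurableSet I → ∀ c : 𝒞, 0 < P {ω | C ω = c} →
      (P[{ω | Y 0 ω = true} ∩ {ω | S ω ∈ I} | {ω | C ω = c}]).toReal
        = ∑ j, (P[{ω | S ω ∈ I} ∩ {ω | Y j ω = true} ∩ {ω | γ ω = j} |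
            {ω | C ω = c}]).toReal / w j := by
  intro I hI c _
  have hY : ∀ j, MeasurableSet {ω | Y j ω = true} := fun j ↦
    hYm j (measurableSet_singleton true)
  have hSI : MeasurableSet {ω | S ω ∈ I} := hS hI
  simp only [cond_apply (hC c), ENNReal.toReal_mul]
  have hterm : ∀ j, (P ({ω | C ω = c} ∩
      ({ω | S ω ∈ I} ∩ {ω | Y j ω = true} ∩ {ω | γ ω = j}))).toReal
      = w j * (P ({ω | S ω ∈ I} ∩ {ω | γ ω = j} ∩ {ω | C ω = c} ∩
          {ω | Y 0 ω = true})).toReal := by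
    intro j
    rw [← hHom j j c I hI]
    congr 1
    apply measure_congr
    filter_upwards [hHier j] with ω hω
    apply propext
    change (C ω = c ∧ (S ω ∈ I ∧ Y j ω = true) ∧ γ ω = j) ↔
      (Y j ω = true ∧ ((S ω ∈ I ∧ γ ω = j) ∧ C ω = c) ∧ Y 0 ω = true)
    tauto
  have hpart : (P ({ω | C ω = c} ∩ ({ω | Y 0 ω = true} ∩ {ω | S ω ∈ I}))).toReal
      = ∑ j, (P ({ω | S ω ∈ I} ∩ {ω | γ ω = j} ∩ {ω | C ω = c} ∩
          {ω | Y 0 ω = true})).toReal := by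
    rw [← ENNReal.toReal_sum fun j _ ↦ measure_ne_top P _,
      ← measure_biUnion_finset (μ := P) (s := Finset.univ)
        (f := fun j ↦ {ω | S ω ∈ I} ∩ {ω | γ ω = j} ∩ {ω | C ω = c} ∩ {ω | Y 0 ω = true})]
    · congr 2
      ext ω
      simp only [Set.mem_inter_iff, Set.mem_ofPred_eq, Set.mem_iUnion, Finset.mem_univ,
        exists_prop, true_and]
      constructor
      · rintro ⟨hc, hy, hs⟩
        exact ⟨γ ω, ⟨⟨hs, rfl⟩, hc⟩, hy⟩
      · rintro ⟨_, ⟨⟨hs, _⟩, hc⟩, hy⟩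
        exact ⟨hc, hy, hs⟩
    · intro i _ j _ hij
      exact Set.disjoint_left.2 fun ω hi hj ↦ hij (hi.1.1.2.symm.trans hj.1.1.2)
    · intro j _
      exact ((hSI.inter (hγ (measurableSet_singleton j))).inter (hC c)).inter (hY 0)
  rw [hpart, Finset.mul_sum]
  refine Finset.sum_congr rfl fun j _ ↦ ?_
  rw [hterm, mul_left_comm, mul_div_cancel_left₀ _ (hwpos j).ne']
end

section
/- Consider the position-bias model: on a probability space (Ω, 𝓕, P), let S : Ω → ℝ be a score, C : Ω → 𝒞 a protected attribute taking values in a countable set 𝒞, γ : Ω → {1,…,K} a position, and Y₁,…,Y_K : Ω → {0,1} counterfactual labels with w_j = P(Y_j = 1 | Y₁ = 1) > 0 for all j. Assume homogeneity: for every j, conditionally on {Y₁ = 1}, Y_j is independent of (S, γ, C) with P(Y_j = 1 | Y₁ = 1, S, γ, C) = w_j almost surely; and preservation of hierarchy: Y_j ≤ Y₁ almost surely for every j. Then for every Borel set I ⊆ ℝ and every c ∈ 𝒞 with P(C = c) > 0: P(Y₁ = 0, S ∈ I | C = c) = P(S ∈ I | C = c) − Σ_{j=1}^{K} P(S ∈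 I, Y_j = 1, γ = j | C = c) / w_j. -/
open MeasureTheory ProbabilityTheory

/-- The measure of a set is the sum of the measures of its intersections with the fibres of a
measurable map to a finite type. -/
lemma sum_toReal_measure_inter_fiber {Ω ι : Type*} [MeasurableSpace Ω] [Fintype ι]
    [MeasurableSpace ι] [MeasurableSingletonClass ι] (P : Measure Ω) [IsFiniteMeasure P]
    {f : Ω → ι} (hf : Measurable f) {A : Set Ω} (hA : MeasurableSet A) :
    ∑ i, (P (A ∩ {ω | f ω = i})).toReal = (P A).toReal := by
  have hU : A = ⋃ i, A ∩ {ω | f ω = i} := by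
    ext ω
    simp
  conv_rhs => rw [hU]
  rw [measure_iUnion, tsum_fintype, ENNReal.toReal_sum fun i _ => measure_ne_top P _]
  · intro i j hij
    refine Set.disjoint_left.2 fun ω hi hj => hij ?_
    exact hi.2.symm.trans hj.2
  · exact fun i => hA.inter (hf (measurableSet_singleton i))

/-- negative-label identity in the proof of Theorem 4 of the paper:
in the position-bias model with homogeneity, preservation of hierarchy and positive
position biases `w j`, the joint probability of the counterfactual negative label and
the score falling in a Borel set is expressed via the complement of the
inverse-propensity-weighted positive-label probability:
`P(Y₁ = 0, S ∈ I | C = c) = P(S ∈ I | C = c) − ∑ j P(S ∈ I, Y_j = 1, γ = j | C = c)/w_j`.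
Positions are indexed by `Fin (K + 1)`, with `0` denoting position 1 (the top). -/
theorem inverse_propensity_identity_negative
    {Ω 𝒞 : Type*} [MeasurableSpace Ω] [Countable 𝒞]
    (P : Measure Ω) [IsProbabilityMeasure P]
    (K : ℕ) (S : Ω → ℝ) (C : Ω → 𝒞) (γ : Ω → Fin (K + 1))
    (Y : Fin (K + 1) → Ω → Bool)
    (hS : Measurable S) (hC : ∀ c, MeasurableSet {ω | C ω = c})
    (hγ : Measurable γ) (hYm : ∀ j, Measurable (Y j))
    (w : Fin (K + 1) → ℝ)
    (hw : ∀ j, w j = (P[{ω | Y j ω = true} | {ω | Y 0 ω = true}]).toReal)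
    (hwpos : ∀ j, 0 < w j)
    (hHom : ∀ (j j' : Fin (K + 1)) (c : 𝒞) (B : Set ℝ), MeasurableSet B →
      (P ({ω | Y j ω = true} ∩
          ({ω | S ω ∈ B} ∩ {ω | γ ω = j'} ∩ {ω | C ω = c} ∩
            {ω | Y 0 ω = true}))).toReal
        = w j * (P ({ω | S ω ∈ B} ∩ {ω | γ ω = j'} ∩ {ω | C ω = c} ∩
            {ω | Y 0 ω = true})).toReal)
    (hHier : ∀ j, ∀ᵐ ω ∂P, Y j ω = true → Y 0 ω = true) :
    ∀ (I : Set ℝ), MeasurableSet I → ∀ c : 𝒞, 0 < P {ω | C ω = c} →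
      (P[{ω | Y 0 ω = false} ∩ {ω | S ω ∈ I} | {ω | C ω = c}]).toReal
        = (P[{ω | S ω ∈ I} | {ω | C ω = c}]).toReal
          - ∑ j, (P[{ω | S ω ∈ I} ∩ {ω | Y j ω = true} ∩ {ω | γ ω = j} |
              {ω | C ω = c}]).toReal / w j := by
  intro I hI c _
  have hSI : MeasurableSet {ω | S ω ∈ I} := hS hI
  have hY0 : MeasurableSet {ω | Y 0 ω = true} := hYm 0 (measurableSet_singleton true)
  have hterm : ∀ j, (P ({ω | C ω = c} ∩
        ({ω | S ω ∈ I} ∩ {ω | Y j ω = true} ∩ {ω | γ ω = j}))).toReal / w j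
      = (P (({ω | C ω = c} ∩ {ω | S ω ∈ I} ∩ {ω | Y 0 ω = true}) ∩ {ω | γ ω = j})).toReal := by
    intro j
    have hae : P ({ω | C ω = c} ∩ ({ω | S ω ∈ I} ∩ {ω | Y j ω = true} ∩ {ω | γ ω = j}))
        = P ({ω | Y j ω = true} ∩ ({ω | S ω ∈ I} ∩ {ω | γ ω = j} ∩ {ω | C ω = c} ∩
            {ω | Y 0 ω = true})) := by
      apply measure_congr
      filter_upwards [hHier j] with ω hω
      apply propext
      change (C ω = c ∧ (S ω ∈ I ∧ Y j ω = true) ∧ γ ω = j) ↔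
        (Y j ω = true ∧ ((S ω ∈ I ∧ γ ω = j) ∧ C ω = c) ∧ Y 0 ω = true)
      tauto
    rw [hae, hHom j j c I hI, mul_div_cancel_left₀ _ (hwpos j).ne']
    congr 2
    ext ω
    simp only [Set.mem_inter_iff, Set.mem_ofPred_eq]
    tauto
  have hsum := sum_toReal_measure_inter_fiber P hγ (((hC c).inter hSI).inter hY0)
  have hsplit : (P ({ω | C ω = c} ∩ {ω | S ω ∈ I} ∩ {ω | Y 0 ω = true})).toReal
      + (P ({ω | C ω = c} ∩ ({ω | Y 0 ω = false} ∩ {ω | S ω ∈ I}))).toReal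
      = (P ({ω | C ω = c} ∩ {ω | S ω ∈ I})).toReal := by
    have hdiff : {ω | C ω = c} ∩ ({ω | Y 0 ω = false} ∩ {ω | S ω ∈ I})
        = ({ω | C ω = c} ∩ {ω | S ω ∈ I}) \ {ω | Y 0 ω = true} := by
      ext ω
      simp only [Set.mem_inter_iff, Set.mem_sdiff, Set.mem_ofPred_eq, Bool.not_eq_true]
      tauto
    rw [hdiff]
    exact measureReal_inter_add_sdiff hY0
  simp only [cond_apply (hC c), ENNReal.toReal_mul, mul_div_assoc, hterm]
  rw [← Finset.mul_sum, hsum, ← hsplit]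
  ring
end
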